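/- arXiv:2101.10415 — 2 statements merged into one kernel-verified Lean document; each statement's English description precedes it below -/
import Mathlib

section
/- Let p ≥ 2 be an integer, let β be an integer with 0 ≤ β ≤ p − 2, and let α₀ = 0 < α₁ < … < α_{p−1} be integers such that α₁ ≥ 3, α_i = 2α_{i−1} − 1 for all i with 2 ≤ i ≤ β + 1, and α_i > 2α_{i−1} − 1 for all i with β + 2 ≤ i ≤ p − 1. Then the square y² of y = 2^{α₀} + 2^{α₁} + … + 2^{α_{p−1}} has exactly p(p+1)/2 − β non-zero digits in its binary representation. -/
/-- The number of non-zero digits of `n` in base `2`. -/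
def binaryWeight (n : ℕ) : ℕ := ((Nat.digits 2 n).filter (· ≠ 0)).length

lemma binaryWeight_zero : binaryWeight 0 = 0 := by simp [binaryWeight]

lemma binaryWeight_eq_mod_add_div (n : ℕ) :
    binaryWeight n = n % 2 + binaryWeight (n / 2) := by
  rcases Nat.eq_zero_or_pos n with rfl | hn
  · simp
  · unfold binaryWeight
    rw [Nat.digits_def' one_lt_two hn, List.filter_cons]
    rcases Nat.mod_two_eq_zero_or_one n with h | h <;> simp [h, add_comm]

lemma binaryWeight_one : binaryWeight 1 = 1 := by simp [binaryWeight]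

lemma binaryWeight_two : binaryWeight 2 = 1 := by simp [binaryWeight]

lemma binaryWeight_add_two_pow_mul (n A B : ℕ) (hA : A < 2 ^ n) :
    binaryWeight (A + 2 ^ n * B) = binaryWeight A + binaryWeight B := by
  induction n generalizing A with
  | zero =>
    obtain rfl : A = 0 := by simpa using hA
    simp [binaryWeight_zero]
  | succ n ih =>
    have h : A + 2 ^ (n + 1) * B = A + 2 * (2 ^ n * B) := by ring
    rw [h, binaryWeight_eq_mod_add_div, binaryWeight_eq_mod_add_div A,
      Nat.add_mul_mod_self_left, Nat.add_mul_div_left _ _ two_pos,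
      ih _ (by rw [pow_succ] at hA; omega), add_assoc]

lemma binaryWeight_add_two_pow (n A : ℕ) (hA : A < 2 ^ n) :
    binaryWeight (A + 2 ^ n) = binaryWeight A + 1 := by
  simpa [binaryWeight_one] using binaryWeight_add_two_pow_mul n A 1 hA

lemma sq_add_two_pow_mul_lt {Y a b : ℕ} (hY : 2 * Y ≤ 3 * 2 ^ b) (hab : b + 2 ≤ a) :
    Y ^ 2 + 2 ^ (a + 1) * Y < 2 ^ (2 * a) := by
  have h : 4 * 2 ^ b ≤ 2 ^ a := by
    calc 4 * 2 ^ b = 2 ^ (b + 2) := by ring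
      _ ≤ 2 ^ a := Nat.pow_le_pow_right two_pos hab
  have ha : 0 < 2 ^ a := by positivity
  have h8 : 8 * Y ≤ 3 * 2 ^ a := by omega
  rw [pow_succ 2 a, two_mul a, pow_add]
  nlinarith [Nat.mul_le_mul h8 h8, Nat.mul_le_mul_left (2 ^ a) h8, Nat.mul_pos ha ha]

/-- If `2 * b < a + 1` the square of `Y` and the shifted copy of `Y` do not overlap. -/
lemma binaryWeight_add_two_pow_mul_of_lt {Y L a b : ℕ} (hL : L < 2 ^ (2 * b))
    (hYL : Y ^ 2 = L + 2 ^ (2 * b)) (hab : 2 * b < a + 1) :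
    binaryWeight (Y ^ 2 + 2 ^ (a + 1) * Y) = binaryWeight L + 1 + binaryWeight Y := by
  have h : 2 * 2 ^ (2 * b) ≤ 2 ^ (a + 1) := by
    calc 2 * 2 ^ (2 * b) = 2 ^ (2 * b + 1) := by ring
      _ ≤ 2 ^ (a + 1) := Nat.pow_le_pow_right two_pos hab
  rw [binaryWeight_add_two_pow_mul _ _ _ (by omega), hYL, binaryWeight_add_two_pow _ _ hL]

/-- If `a + 1 = 2 * b` the leading digit of the square of `Y` is absorbed by a carry. -/
lemma binaryWeight_add_two_pow_mul_of_eq {Y L a b : ℕ} (hL : L < 2 ^ (2 * b))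
    (hYL : Y ^ 2 = L + 2 ^ (2 * b)) (hab : a + 1 = 2 * b) (hY : Y % 8 = 1) :
    binaryWeight (Y ^ 2 + 2 ^ (a + 1) * Y) = binaryWeight L + binaryWeight Y := by
  obtain ⟨q, rfl⟩ : ∃ q, Y = 1 + 2 ^ 3 * q := ⟨Y / 8, by omega⟩
  have h : (1 + 2 ^ 3 * q) ^ 2 + 2 ^ (a + 1) * (1 + 2 ^ 3 * q)
      = L + 2 ^ (2 * b) * (2 + 2 ^ 3 * q) := by rw [hYL, hab]; ring
  rw [h, binaryWeight_add_two_pow_mul _ _ _ hL,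
    binaryWeight_add_two_pow_mul 3 2 q (by norm_num),
    binaryWeight_add_two_pow_mul 3 1 q (by norm_num), binaryWeight_one, binaryWeight_two]

theorem binary_digit_count_of_square_of_sum_of_powers
    (p β : ℕ) (hp : 2 ≤ p) (hβ : β ≤ p - 2)
    (α : ℕ → ℕ) (hα0 : α 0 = 0) (hα1 : 3 ≤ α 1)
    (hmono : ∀ i, i + 1 < p → α i < α (i + 1))
    (heq : ∀ i, 2 ≤ i → i ≤ β + 1 → α i = 2 * α (i - 1) - 1)
    (hgt : ∀ i, β + 2 ≤ i → i ≤ p - 1 → α i > 2 * α (i - 1) - 1) :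
    ((Nat.digits 2 ((∑ i ∈ Finset.range p, 2 ^ α i) ^ 2)).filter (· ≠ 0)).length
      = p * (p + 1) / 2 - β := by
  have hα3 : ∀ k, 1 ≤ k → k < p → 3 ≤ α k := by
    intro k hk
    induction k, hk using Nat.le_induction with
    | base => exact fun _ => hα1
    | succ k _ ih => exact fun h => (ih (by omega)).trans (hmono k h).le
  have key : ∀ k, k < p → ∃ L, L < 2 ^ (2 * α k) ∧
      (∑ i ∈ Finset.range (k + 1), 2 ^ α i) ^ 2 = L + 2 ^ (2 * α k) ∧
      (∑ i ∈ Finset.range (k + 1), 2 ^ α i) % 8 = 1 ∧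
      2 * (∑ i ∈ Finset.range (k + 1), 2 ^ α i) ≤ 3 * 2 ^ α k ∧
      binaryWeight (∑ i ∈ Finset.range (k + 1), 2 ^ α i) = k + 1 ∧
      2 * (binaryWeight L + 1 + min β (k - 1)) = (k + 1) * (k + 2) := by
    intro k
    induction k with
    | zero => exact fun _ => ⟨0, by simp [hα0, binaryWeight_zero, binaryWeight_one]⟩
    | succ k ih =>
      intro hk
      obtain ⟨L, hL, hYL, hY8, hY, hwY, hwL⟩ := ih (by omega)
      clear ih
      rw [Finset.sum_range_succ _ (k + 1)]
      set Y := ∑ i ∈ Finset.range (k + 1), 2 ^ α i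
      have ha3 := hα3 (k + 1) (by omega) hk
      have hcase : (α (k + 1) + 1 = 2 * α k ∧ 1 ≤ k ∧ k ≤ β) ∨
          (2 * α k < α (k + 1) + 1 ∧ (k = 0 ∨ β < k)) := by
        rcases Nat.eq_zero_or_pos k with rfl | hk0
        · right; simp [hα0]
        · have hb3 := hα3 k hk0 (by omega)
          by_cases hkβ : k ≤ β
          · have := heq (k + 1) (by omega) (by omega)
            simp only [Nat.add_sub_cancel] at this
            left; omega
          · have := hgt (k + 1) (by omega) (by omega)
            simp only [Nat.add_sub_cancel] at this
            right; omega
      have hab : α k + 2 ≤ α (k + 1) := by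
        rcases Nat.eq_zero_or_pos k with rfl | hk0
        · simp only [zero_add] at *; omega
        · have hb3 := hα3 k hk0 (by omega)
          omega
      have hpow : 4 * 2 ^ α k ≤ 2 ^ α (k + 1) := by
        calc 4 * 2 ^ α k = 2 ^ (α k + 2) := by ring
          _ ≤ 2 ^ α (k + 1) := Nat.pow_le_pow_right two_pos hab
      have h8 : 8 ∣ 2 ^ α (k + 1) := pow_dvd_pow 2 ha3
      refine ⟨Y ^ 2 + 2 ^ (α (k + 1) + 1) * Y, sq_add_two_pow_mul_lt hY hab, by ring, by omega,
        by omega, ?_, ?_⟩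
      · rw [binaryWeight_add_two_pow _ _ (by omega), hwY]
      · rcases hcase with ⟨h, hk1, hkβ⟩ | ⟨h, hkβ⟩
        · rw [binaryWeight_add_two_pow_mul_of_eq hL hYL h hY8, hwY]
          rw [min_eq_right (by omega)] at hwL ⊢
          simp only [Nat.add_sub_cancel]
          have : k - 1 + 1 = k := by omega
          nlinarith
        · rw [binaryWeight_add_two_pow_mul_of_lt hL hYL h, hwY]
          have : min β (k + 1 - 1) = min β (k - 1) := by omega
          rw [this]
          nlinarith
  obtain ⟨L, hL, hYL, -, -, -, hwL⟩ := key (p - 1) (by omega)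
  rw [show p - 1 + 1 = p by omega] at hYL hwL
  rw [show p - 1 + 2 = p + 1 by omega, min_eq_left (by omega)] at hwL
  change binaryWeight _ = _
  rw [hYL, binaryWeight_add_two_pow _ _ hL]
  omega
end

section
/- Let k ≥ 4 be an integer of the form p(p−1)/2 + 1 for some positive integer p. Then there are infinitely many perfect squares not divisible by 5 having exactly k non-zero digits in their base-5 representation. -/
/-- The number of non-zero base-5 digits. -/
def nonzeroDigitCount (n : ℕ) : ℕ := ((Nat.digits 5 n).filter (· ≠ 0)).length

theorem nonzeroDigitCount_add_mul (r q : ℕ) (hr : r < 5) :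
    nonzeroDigitCount (r + 5 * q) = (if r = 0 then 0 else 1) + nonzeroDigitCount q := by
  unfold nonzeroDigitCount
  by_cases h : r = 0
  · subst h
    rcases Nat.eq_zero_or_pos q with rfl | hq
    · simp
    · rw [Nat.digits_add 5 (by norm_num) 0 q (by norm_num) (Or.inr hq.ne')]
      simp
  · rw [Nat.digits_add 5 (by norm_num) r q hr (Or.inl h)]
    simp [h, add_comm]

theorem nonzeroDigitCount_add_pow_mul (e a b : ℕ) (ha : a < 5 ^ e) :
    nonzeroDigitCount (a + 5 ^ e * b) = nonzeroDigitCount a + nonzeroDigitCount b := by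
  induction e generalizing a with
  | zero =>
    obtain rfl : a = 0 := by simpa using ha
    simp [nonzeroDigitCount]
  | succ e ih =>
    have hlt : a / 5 < 5 ^ e := by rw [pow_succ] at ha; omega
    have hmod : a % 5 < 5 := Nat.mod_lt _ (by norm_num)
    have hsplit : a + 5 ^ (e + 1) * b = a % 5 + 5 * (a / 5 + 5 ^ e * b) := by
      rw [pow_succ]
      linarith [Nat.mod_add_div a 5]
    have hcount := nonzeroDigitCount_add_mul (a % 5) (a / 5) hmod
    rw [Nat.mod_add_div] at hcount
    rw [hsplit, nonzeroDigitCount_add_mul _ _ hmod, ih _ hlt, hcount, add_assoc]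

/-- Roots of the form `2 + 2 * 5 ^ e₀ + 5 ^ e₁ + ⋯ + 5 ^ eₜ` with rapidly growing exponents. -/
theorem exists_large_root_nonzeroDigitCount (t N : ℕ) :
    ∃ m, N ≤ m ∧ ¬ 5 ∣ m ∧ nonzeroDigitCount (2 * m) = t + 2 ∧
      2 * nonzeroDigitCount (m ^ 2) = (t + 2) * (t + 3) + 2 := by
  induction t with
  | zero =>
    have hN : N + 2 < 5 ^ (N + 2) := Nat.lt_pow_self (by norm_num)
    have h25 : 25 ≤ 5 ^ (N + 2) := by
      simpa using Nat.pow_le_pow_right (show 0 < 5 by norm_num) (show 2 ≤ N + 2 by omega)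
    have hdvd : 5 ∣ 5 ^ (N + 2) := dvd_pow_self 5 (by omega)
    have h4 : nonzeroDigitCount 4 = 1 := by norm_num [nonzeroDigitCount]
    have h8 : nonzeroDigitCount 8 = 2 := by norm_num [nonzeroDigitCount]
    refine ⟨2 + 2 * 5 ^ (N + 2), by omega, by omega, ?_, ?_⟩
    · rw [show 2 * (2 + 2 * 5 ^ (N + 2)) = 4 + 5 ^ (N + 2) * 4 by ring,
        nonzeroDigitCount_add_pow_mul _ _ _ (by omega), h4]
    · rw [show (2 + 2 * 5 ^ (N + 2)) ^ 2 = 4 + 5 ^ (N + 2) * (8 + 5 ^ (N + 2) * 4) by ring,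
        nonzeroDigitCount_add_pow_mul _ _ _ (by omega),
        nonzeroDigitCount_add_pow_mul _ _ _ (by omega), h4, h8]
  | succ t ih =>
    obtain ⟨m, hNm, h5, htwo, hsq⟩ := ih
    obtain ⟨e, he⟩ : ∃ e, e = m ^ 2 + 2 * m + 1 := ⟨_, rfl⟩
    have hlt : e < 5 ^ e := Nat.lt_pow_self (by norm_num)
    have hdvd : 5 ∣ 5 ^ e := dvd_pow_self 5 (by omega)
    have h1 : nonzeroDigitCount 1 = 1 := by norm_num [nonzeroDigitCount]
    have h2 : nonzeroDigitCount 2 = 1 := by norm_num [nonzeroDigitCount]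
    refine ⟨m + 5 ^ e, by omega, by omega, ?_, ?_⟩
    · rw [show 2 * (m + 5 ^ e) = 2 * m + 5 ^ e * 2 by ring,
        nonzeroDigitCount_add_pow_mul _ _ _ (by omega), htwo, h2]
    · rw [show (m + 5 ^ e) ^ 2 = m ^ 2 + 5 ^ e * (2 * m + 5 ^ e * 1) by ring,
        nonzeroDigitCount_add_pow_mul _ _ _ (by omega),
        nonzeroDigitCount_add_pow_mul _ _ _ (by omega), htwo, h1]
      linarith

theorem infinitely_many_squares_base_five_triangular_form
    (k : ℕ) (hk : 4 ≤ k)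
    (hform : ∃ p : ℕ, 0 < p ∧ k = p * (p - 1) / 2 + 1) :
    {n : ℕ | ¬ (5 : ℕ) ∣ n ∧ (∃ m : ℕ, n = m ^ 2) ∧
      ((Nat.digits 5 n).filter (· ≠ 0)).length = k}.Infinite := by
  obtain ⟨p, -, hkp⟩ := hform
  have hp : 3 ≤ p := by
    by_contra! h
    interval_cases p <;> omega
  obtain ⟨t, rfl⟩ := Nat.exists_eq_add_of_le' hp
  refine Set.infinite_of_forall_exists_gt fun N => ?_
  obtain ⟨m, hm, h5, -, hsq⟩ := exists_large_root_nonzeroDigitCount t (N + 1)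
  refine ⟨m ^ 2, ⟨fun h => h5 (Nat.prime_five.dvd_of_dvd_pow h), ⟨m, rfl⟩, ?_⟩, by nlinarith⟩
  change nonzeroDigitCount (m ^ 2) = k
  rw [show t + 3 - 1 = t + 2 by omega, mul_comm] at hkp
  omega
end
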